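/- Let n ≥ 2 and let ρ be a binary choice rule on ℝⁿ in which every attribute is non-null. Then ρ satisfies M1–M6 if and only if it has an L1-complexity representation (G, β). Moreover, if ρ has L1-complexity representations (G, β) and (G', β'), then G' = G and β' = Cβ for some C > 0. -/

import Mathlib

open Finset

variable {n : ℕ}

/-- A binary choice rule: values in [0,1] with ρ(x,y) = 1 - ρ(y,x). -/
def IsBCR {X : Type*} (ρ : X → X → ℝ) : Prop :=
  (∀ x y, ρ x y ∈ Set.Icc (0:ℝ) 1) ∧ ∀ x y, ρ x y = 1 - ρ y x

/-- M1 (Continuity). -/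
def M1 (ρ : (Fin n → ℝ) → (Fin n → ℝ) → ℝ) : Prop :=
  ContinuousOn (fun p : (Fin n → ℝ) × (Fin n → ℝ) => ρ p.1 p.2) {p | p.1 ≠ p.2}

/-- M2 (Linearity). -/
def M2 (ρ : (Fin n → ℝ) → (Fin n → ℝ) → ℝ) : Prop :=
  ∀ (x y z : Fin n → ℝ) (α : ℝ), 0 < α → α < 1 →
    ρ x y = ρ (α • x + (1 - α) • z) (α • y + (1 - α) • z)

/-- M3 (Moderate Transitivity). -/
def M3 {X : Type*} (ρ : X → X → ℝ) : Prop :=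
  ∀ x y z, 1/2 ≤ ρ x y → 1/2 ≤ ρ y z →
    min (ρ x y) (ρ y z) < ρ x z ∨ (ρ x z = ρ x y ∧ ρ x z = ρ y z)

/-- The revealed dominance relation x >_D y. -/
def DomD (ρ : (Fin n → ℝ) → (Fin n → ℝ) → ℝ) (x y : Fin n → ℝ) : Prop :=
  (∀ k, 1/2 ≤ ρ (Function.update y k (x k)) y) ∧
  ∃ k, 1/2 < ρ (Function.update y k (x k)) y

/-- M4 (Dominance). -/
def M4 (ρ : (Fin n → ℝ) → (Fin n → ℝ) → ℝ) : Prop :=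
  ∀ x y, DomD ρ x y → ∀ w z, ρ w z ≤ ρ x y ∧ (¬ DomD ρ w z → ρ w z < ρ x y)

/-- M5 (Simplification). -/
def M5 (ρ : (Fin n → ℝ) → (Fin n → ℝ) → ℝ) : Prop :=
  ∀ x y x' : Fin n → ℝ, 1/2 ≤ ρ x y →
    (∃ i, x' i = y i ∧
      ∀ j j', j ≠ i → j' ≠ i → x' j ≠ x j → x' j' ≠ x j' → j = j') →
    ρ x' x = 1/2 → ρ x y ≤ ρ x' y

/-- Attribute k is null. -/
def NullAttr (ρ : (Fin n → ℝ) → (Fin n → ℝ) → ℝ) (k : Fin n) : Prop :=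
  ∀ x y z : Fin n → ℝ,
    ρ (Function.update z k (x k)) (Function.update z k (y k)) = 1/2

/-- L1-complexity representation (G, β). -/
def IsL1Rep (ρ : (Fin n → ℝ) → (Fin n → ℝ) → ℝ) (G : ℝ → ℝ) (β : Fin n → ℝ) : Prop :=
  (∀ k, β k ≠ 0) ∧
  ContinuousOn G (Set.Icc (-1) 1) ∧
  StrictMonoOn G (Set.Icc (-1) 1) ∧
  (∀ r ∈ Set.Icc (-1:ℝ) 1, G r ∈ Set.Icc (0:ℝ) 1 ∧ G r = 1 - G (-r)) ∧
  ∀ x y : Fin n → ℝ, x ≠ y →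
    ρ x y = G ((∑ k, β k * x k - ∑ k, β k * y k) / ∑ k, |β k * (x k - y k)|)

/-- M6 (Exchangeability). -/
def M6 (ρ : (Fin n → ℝ) → (Fin n → ℝ) → ℝ) : Prop :=
  ∀ i j : Fin n, i ≠ j → ∀ x x' : Fin n → ℝ,
    (∀ m, m ≠ i → m ≠ j → x m = 0 ∧ x' m = 0) →
    ρ (Pi.single i (x i)) (Pi.single j (x' j)) = 1/2 →
    ρ (Pi.single j (x j)) (Pi.single i (x' i)) = 1/2 →
    ρ x 0 = ρ x' 0

/-- The signed weighted sum of the attribute differences `v`. -/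
def weightedSum (β v : Fin n → ℝ) : ℝ := ∑ k, β k * v k

/-- The weighted `L1` norm of the attribute differences `v`. -/
def weightedL1 (β v : Fin n → ℝ) : ℝ := ∑ k, |β k * v k|

/-- The ratio of the value difference to the `L1` distance. -/
noncomputable def l1Ratio (β v : Fin n → ℝ) : ℝ := weightedSum β v / weightedL1 β v

section Ratio

variable (β : Fin n → ℝ)

lemma weightedSum_add (u v : Fin n → ℝ) :
    weightedSum β (u + v) = weightedSum β u + weightedSum β v := by
  simp [weightedSum, mul_add, Finset.sum_add_distrib]

lemma weightedSum_sub (u v : Fin n → ℝ) :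
    weightedSum β (u - v) = weightedSum β u - weightedSum β v := by
  simp [weightedSum, mul_sub, Finset.sum_sub_distrib]

lemma weightedSum_neg (v : Fin n → ℝ) : weightedSum β (-v) = -weightedSum β v := by
  simp [weightedSum]

lemma weightedSum_smul (c : ℝ) (v : Fin n → ℝ) :
    weightedSum β (c • v) = c * weightedSum β v := by
  simp [weightedSum, Finset.mul_sum, mul_left_comm]

lemma weightedSum_smul_left (c : ℝ) (v : Fin n → ℝ) :
    weightedSum (c • β) v = c * weightedSum β v := by
  simp [weightedSum, Finset.mul_sum, mul_assoc]

lemma weightedL1_smul {c : ℝ} (hc : 0 < c) (v : Fin n → ℝ) :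
    weightedL1 β (c • v) = c * weightedL1 β v := by
  simp [weightedL1, Finset.mul_sum, abs_mul, abs_of_pos hc, mul_left_comm]

lemma weightedL1_smul_left {c : ℝ} (hc : 0 < c) (v : Fin n → ℝ) :
    weightedL1 (c • β) v = c * weightedL1 β v := by
  simp [weightedL1, Finset.mul_sum, abs_mul, abs_of_pos hc, mul_assoc]

lemma weightedL1_add_le (u v : Fin n → ℝ) :
    weightedL1 β (u + v) ≤ weightedL1 β u + weightedL1 β v := by
  rw [weightedL1, weightedL1, weightedL1, ← Finset.sum_add_distrib]
  refine Finset.sum_le_sum fun k _ => ?_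
  rw [Pi.add_apply, mul_add]
  exact abs_add_le _ _

lemma weightedL1_nonneg (v : Fin n → ℝ) : 0 ≤ weightedL1 β v :=
  Finset.sum_nonneg fun _ _ => abs_nonneg _

lemma abs_weightedSum_le (v : Fin n → ℝ) : |weightedSum β v| ≤ weightedL1 β v :=
  Finset.abs_sum_le_sum_abs _ _

lemma weightedL1_pos {β : Fin n → ℝ} (hβ : ∀ k, β k ≠ 0) {v : Fin n → ℝ} (hv : v ≠ 0) :
    0 < weightedL1 β v := by
  obtain ⟨k, hk⟩ := Function.ne_iff.mp hv
  exact Finset.sum_pos' (fun _ _ => abs_nonneg _)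
    ⟨k, Finset.mem_univ _, abs_pos.mpr (mul_ne_zero (hβ k) hk)⟩

lemma l1Ratio_zero : l1Ratio β 0 = 0 := by simp [l1Ratio, weightedSum]

lemma l1Ratio_smul {c : ℝ} (hc : 0 < c) (v : Fin n → ℝ) :
    l1Ratio β (c • v) = l1Ratio β v := by
  rw [l1Ratio, weightedSum_smul, weightedL1_smul β hc, mul_div_mul_left _ _ hc.ne', l1Ratio]

lemma l1Ratio_smul_left {c : ℝ} (hc : 0 < c) (v : Fin n → ℝ) :
    l1Ratio (c • β) v = l1Ratio β v := by
  rw [l1Ratio, weightedSum_smul_left, weightedL1_smul_left β hc, mul_div_mul_left _ _ hc.ne',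
    l1Ratio]

lemma l1Ratio_mem (v : Fin n → ℝ) : l1Ratio β v ∈ Set.Icc (-1 : ℝ) 1 := by
  have h := abs_le.mp (abs_weightedSum_le β v)
  have h0 := weightedL1_nonneg β v
  rcases h0.eq_or_lt with h0 | h0
  · rw [l1Ratio, ← h0, div_zero]; norm_num
  · rw [l1Ratio, Set.mem_Icc, le_div_iff₀ h0, div_le_iff₀ h0]
    constructor <;> linarith [h.1, h.2]

lemma weightedSum_eq_mul (v : Fin n → ℝ) :
    weightedSum β v = l1Ratio β v * weightedL1 β v := by
  have h := abs_weightedSum_le β v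
  rcases (weightedL1_nonneg β v).eq_or_lt with h0 | h0
  · rw [← h0, mul_zero]
    exact abs_nonpos_iff.mp (h0 ▸ h)
  · rw [l1Ratio, div_mul_cancel₀ _ h0.ne']

lemma l1Ratio_nonneg_iff (v : Fin n → ℝ) : 0 ≤ l1Ratio β v ↔ 0 ≤ weightedSum β v := by
  constructor
  · intro h
    rw [weightedSum_eq_mul]
    exact mul_nonneg h (weightedL1_nonneg β v)
  · intro h
    exact div_nonneg h (weightedL1_nonneg β v)

lemma l1Ratio_eq_zero_iff (v : Fin n → ℝ) : l1Ratio β v = 0 ↔ weightedSum β v = 0 := by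
  constructor
  · intro h
    rw [weightedSum_eq_mul, h, zero_mul]
  · intro h
    rw [l1Ratio, h, zero_div]

/-- The ratio is moderately transitive. -/
lemma l1Ratio_moderate {β : Fin n → ℝ} (hβ : ∀ k, β k ≠ 0) (u v : Fin n → ℝ)
    (hu : 0 ≤ l1Ratio β u) (hv : 0 ≤ l1Ratio β v) :
    min (l1Ratio β u) (l1Ratio β v) < l1Ratio β (u + v) ∨
      (l1Ratio β (u + v) = l1Ratio β u ∧ l1Ratio β (u + v) = l1Ratio β v) := by
  by_cases hu0 : u = 0
  · subst hu0
    rw [zero_add, l1Ratio_zero]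
    rcases hv.eq_or_lt with h | h
    · exact Or.inr ⟨h.symm, rfl⟩
    · exact Or.inl (min_lt_iff.mpr (Or.inl h))
  by_cases hv0 : v = 0
  · subst hv0
    rw [add_zero, l1Ratio_zero]
    rcases hu.eq_or_lt with h | h
    · exact Or.inr ⟨rfl, h.symm⟩
    · exact Or.inl (min_lt_iff.mpr (Or.inr h))
  have hdu := weightedL1_pos hβ hu0
  have hdv := weightedL1_pos hβ hv0
  have hsu := weightedSum_eq_mul β u
  have hsv := weightedSum_eq_mul β v
  have hs := weightedSum_eq_mul β (u + v)
  have hle := weightedL1_add_le β u v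
  rw [weightedSum_add] at hs
  have hm0 : 0 ≤ min (l1Ratio β u) (l1Ratio β v) := le_min hu hv
  have hmu : min (l1Ratio β u) (l1Ratio β v) ≤ l1Ratio β u := min_le_left _ _
  have hmv : min (l1Ratio β u) (l1Ratio β v) ≤ l1Ratio β v := min_le_right _ _
  generalize min (l1Ratio β u) (l1Ratio β v) = m at *
  by_cases hlt : m < l1Ratio β (u + v)
  · exact Or.inl hlt
  right
  push Not at hlt
  have h1 : (l1Ratio β u - m) * weightedL1 β u + (l1Ratio β v - m) * weightedL1 β v ≤ 0 := by
    have h2 := mul_le_mul_of_nonneg_right hlt (weightedL1_nonneg β (u + v))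
    have h3 := mul_le_mul_of_nonneg_left hle hm0
    linarith
  have h2 := mul_nonneg (sub_nonneg.mpr hmu) hdu.le
  have h3 := mul_nonneg (sub_nonneg.mpr hmv) hdv.le
  have h4 : l1Ratio β u = m := by
    have : (l1Ratio β u - m) * weightedL1 β u = 0 := by linarith
    rcases mul_eq_zero.mp this with h | h
    · linarith
    · exact absurd h hdu.ne'
  have h5 : l1Ratio β v = m := by
    have : (l1Ratio β v - m) * weightedL1 β v = 0 := by linarith
    rcases mul_eq_zero.mp this with h | h
    · linarith
    · exact absurd h hdv.ne'
  have h6 : m ≤ l1Ratio β (u + v) := by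
    by_cases h0 : u + v = 0
    · have hz := weightedSum_add β u v
      rw [h0] at hz
      have hz0 : weightedSum β 0 = 0 := by simp [weightedSum]
      have := mul_nonneg hm0 hdv.le
      have hmz : m * weightedL1 β u = 0 := by
        have := mul_nonneg hm0 hdu.le
        rw [h4] at hsu
        rw [h5] at hsv
        linarith
      rcases mul_eq_zero.mp hmz with h | h
      · rw [h, h0, l1Ratio_zero]
      · exact absurd h hdu.ne'
    · rw [l1Ratio, le_div_iff₀ (weightedL1_pos hβ h0), weightedSum_add, hsu, hsv, h4, h5]
      have := mul_le_mul_of_nonneg_left hle hm0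
      linarith
  constructor <;> linarith

lemma l1Ratio_eq_one {v : Fin n → ℝ} (hnn : ∀ k, 0 ≤ β k * v k) (hpos : ∃ k, 0 < β k * v k) :
    l1Ratio β v = 1 := by
  obtain ⟨k, hk⟩ := hpos
  have h : weightedL1 β v = weightedSum β v :=
    Finset.sum_congr rfl fun k _ => abs_of_nonneg (hnn k)
  have h0 : 0 < weightedSum β v :=
    Finset.sum_pos' (fun k _ => hnn k) ⟨k, Finset.mem_univ _, hk⟩
  rw [l1Ratio, h, div_self h0.ne']

lemma nonneg_of_l1Ratio_eq_one {v : Fin n → ℝ} (h : l1Ratio β v = 1) :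
    (∀ k, 0 ≤ β k * v k) ∧ ∃ k, 0 < β k * v k := by
  have hs := weightedSum_eq_mul β v
  rw [h, one_mul] at hs
  have hnn : ∀ k, 0 ≤ β k * v k := by
    have h0 : ∑ k, (|β k * v k| - β k * v k) = 0 := by
      rw [Finset.sum_sub_distrib]
      exact sub_eq_zero.mpr hs.symm
    have h1 := (Finset.sum_eq_zero_iff_of_nonneg
      (fun k _ => sub_nonneg.mpr (le_abs_self (β k * v k)))).mp h0
    intro k
    have := h1 k (Finset.mem_univ _)
    have h2 := abs_nonneg (β k * v k)
    linarith
  refine ⟨hnn, ?_⟩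
  by_contra! hc
  have : weightedSum β v = 0 :=
    Finset.sum_eq_zero fun k _ => le_antisymm (hc k) (hnn k)
  rw [l1Ratio, this, zero_div] at h
  exact zero_ne_one h

lemma continuousOn_l1Ratio {β : Fin n → ℝ} (hβ : ∀ k, β k ≠ 0) :
    ContinuousOn (l1Ratio β) {v | v ≠ 0} := by
  unfold l1Ratio
  refine ContinuousOn.div ?_ ?_ fun v hv => (weightedL1_pos hβ hv).ne'
  · unfold weightedSum; fun_prop
  · unfold weightedL1; fun_prop

end Ratio

section Representation

variable {ρ : (Fin n → ℝ) → (Fin n → ℝ) → ℝ} {G : ℝ → ℝ} {β : Fin n → ℝ}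

lemma IsL1Rep.apply_zero (h : IsL1Rep ρ G β) : G 0 = 1 / 2 := by
  have := (h.2.2.2.1 0 (by norm_num)).2
  rw [neg_zero] at this
  linarith

lemma IsBCR.self (hρ : IsBCR ρ) (x : Fin n → ℝ) : ρ x x = 1 / 2 := by
  have := hρ.2 x x
  linarith

lemma IsL1Rep.eq (h : IsL1Rep ρ G β) (hρ : IsBCR ρ) (x y : Fin n → ℝ) :
    ρ x y = G (l1Ratio β (x - y)) := by
  by_cases hxy : x = y
  · rw [hxy, sub_self, l1Ratio_zero, h.apply_zero, hρ.self]
  · rw [h.2.2.2.2 x y hxy, l1Ratio, weightedSum_sub]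
    rfl

lemma IsL1Rep.le_iff (h : IsL1Rep ρ G β) (hρ : IsBCR ρ) (x y z w : Fin n → ℝ) :
    ρ x y ≤ ρ z w ↔ l1Ratio β (x - y) ≤ l1Ratio β (z - w) := by
  rw [h.eq hρ, h.eq hρ]
  exact h.2.2.1.le_iff_le (l1Ratio_mem _ _) (l1Ratio_mem _ _)

lemma IsL1Rep.lt_iff (h : IsL1Rep ρ G β) (hρ : IsBCR ρ) (x y z w : Fin n → ℝ) :
    ρ x y < ρ z w ↔ l1Ratio β (x - y) < l1Ratio β (z - w) := by
  rw [h.eq hρ, h.eq hρ]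
  exact h.2.2.1.lt_iff_lt (l1Ratio_mem _ _) (l1Ratio_mem _ _)

lemma IsL1Rep.half_le_iff (h : IsL1Rep ρ G β) (hρ : IsBCR ρ) (x y : Fin n → ℝ) :
    1 / 2 ≤ ρ x y ↔ 0 ≤ weightedSum β (x - y) := by
  rw [← hρ.self 0, h.le_iff hρ, sub_self, l1Ratio_zero, l1Ratio_nonneg_iff]

lemma IsL1Rep.eq_half_iff (h : IsL1Rep ρ G β) (hρ : IsBCR ρ) (x y : Fin n → ℝ) :
    ρ x y = 1 / 2 ↔ weightedSum β (x - y) = 0 := by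
  rw [← hρ.self 0, h.eq hρ, h.eq hρ, sub_self, l1Ratio_zero, ← l1Ratio_eq_zero_iff]
  exact h.2.2.1.injOn.eq_iff (l1Ratio_mem _ _) (by norm_num)

lemma weightedSum_update_sub (β x y : Fin n → ℝ) (k : Fin n) :
    weightedSum β (Function.update y k (x k) - y) = β k * (x - y) k := by
  rw [weightedSum, Fintype.sum_eq_single k]
  · simp
  · intro j hj
    simp [hj]

lemma IsL1Rep.domD_iff (h : IsL1Rep ρ G β) (hρ : IsBCR ρ) (x y : Fin n → ℝ) :
    DomD ρ x y ↔ l1Ratio β (x - y) = 1 := by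
  have h1 : ∀ k, 1 / 2 ≤ ρ (Function.update y k (x k)) y ↔ 0 ≤ β k * (x - y) k := fun k => by
    rw [h.half_le_iff hρ, weightedSum_update_sub]
  have h2 : ∀ k, 1 / 2 < ρ (Function.update y k (x k)) y ↔ 0 < β k * (x - y) k := fun k => by
    have := h.eq_half_iff hρ (Function.update y k (x k)) y
    rw [weightedSum_update_sub] at this
    rw [lt_iff_le_and_ne, lt_iff_le_and_ne, h1, ne_comm, Ne, this, ne_comm (a := (0 : ℝ))]
  unfold DomD
  simp only [h1, h2]
  exact ⟨fun hd => l1Ratio_eq_one β hd.1 hd.2, nonneg_of_l1Ratio_eq_one β⟩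

lemma IsL1Rep.m1 (h : IsL1Rep ρ G β) (hρ : IsBCR ρ) : M1 ρ := by
  unfold M1
  simp only [h.eq hρ]
  refine h.2.1.comp ?_ fun p _ => l1Ratio_mem _ _
  refine (continuousOn_l1Ratio h.1).comp (by fun_prop) fun p hp => ?_
  exact sub_ne_zero.mpr hp

lemma IsL1Rep.m2 (h : IsL1Rep ρ G β) (hρ : IsBCR ρ) : M2 ρ := by
  intro x y z α hα _
  rw [h.eq hρ, h.eq hρ, add_sub_add_right_eq_sub, ← smul_sub, l1Ratio_smul β hα]

lemma IsL1Rep.m3 (h : IsL1Rep ρ G β) (hρ : IsBCR ρ) : M3 ρ := by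
  intro x y z hxy hyz
  rw [h.half_le_iff hρ, ← l1Ratio_nonneg_iff] at hxy hyz
  have := l1Ratio_moderate h.1 _ _ hxy hyz
  rw [sub_add_sub_cancel] at this
  rcases this with h1 | ⟨h1, h2⟩
  · left
    rw [min_lt_iff] at h1 ⊢
    rwa [h.lt_iff hρ, h.lt_iff hρ]
  · right
    rw [h.eq hρ x z, h.eq hρ x y, h.eq hρ y z]
    exact ⟨congrArg G h1, congrArg G h2⟩

lemma IsL1Rep.m4 (h : IsL1Rep ρ G β) (hρ : IsBCR ρ) : M4 ρ := by
  intro x y hxy w z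
  rw [h.domD_iff hρ] at hxy ⊢
  rw [h.le_iff hρ, h.lt_iff hρ, hxy]
  exact ⟨(l1Ratio_mem _ _).2, fun hne => lt_of_le_of_ne (l1Ratio_mem _ _).2 hne⟩

lemma IsL1Rep.m5 (h : IsL1Rep ρ G β) (hρ : IsBCR ρ) : M5 ρ := by
  rintro x y x' hxy ⟨i, hi, hj⟩ hx'
  rw [h.half_le_iff hρ] at hxy
  rw [h.eq_half_iff hρ] at hx'
  rw [h.le_iff hρ]
  have hs : weightedSum β (x' - y) = weightedSum β (x - y) := by
    rw [← sub_add_sub_cancel x' x y, weightedSum_add, hx', zero_add]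
  by_cases hxy' : x' = y
  · have : weightedSum β (x - y) = 0 := by
      rw [← hs, hxy', sub_self]; simp [weightedSum]
    rw [l1Ratio, l1Ratio, hs, this, zero_div, zero_div]
  have hd : weightedL1 β (x' - y) ≤ weightedL1 β (x - y) := by
    by_cases hex : ∃ j, j ≠ i ∧ x' j ≠ x j
    · obtain ⟨j, hji, hjx⟩ := hex
      have hoth : ∀ k, k ≠ i ∧ k ≠ j → x' k = x k := by
        rintro k ⟨hki, hkj⟩
        by_contra hne
        exact hkj (hj k j hki hji hne hjx)
      have h1 : weightedSum β (x' - x) = β i * (x' - x) i + β j * (x' - x) j :=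
        Fintype.sum_eq_add i j hji.symm fun k hk => by simp [hoth k hk]
      have h2 : weightedL1 β (x' - y) - weightedL1 β (x - y) =
          (|β i * (x' - y) i| - |β i * (x - y) i|) + (|β j * (x' - y) j| - |β j * (x - y) j|) := by
        rw [weightedL1, weightedL1, ← Finset.sum_sub_distrib]
        exact Fintype.sum_eq_add i j hji.symm fun k hk => by simp [hoth k hk]
      rw [hx'] at h1
      simp only [Pi.sub_apply] at h1 h2
      rw [hi, sub_self, mul_zero, abs_zero] at h2
      rw [hi] at h1
      have h3 : β j * (x' j - y j) = β i * (x i - y i) + β j * (x j - y j) := by linarith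
      have h4 := abs_add_le (β i * (x i - y i)) (β j * (x j - y j))
      rw [h3] at h2
      linarith
    · push Not at hex
      refine Finset.sum_le_sum fun k _ => ?_
      by_cases hk : k = i
      · subst hk
        rw [Pi.sub_apply, hi, sub_self, mul_zero, abs_zero]
        exact abs_nonneg _
      · simp [hex k hk]
  rw [l1Ratio, l1Ratio, hs]
  exact div_le_div_of_nonneg_left hxy (weightedL1_pos h.1 (sub_ne_zero.mpr hxy')) hd

lemma IsL1Rep.m6 (h : IsL1Rep ρ G β) (hρ : IsBCR ρ) : M6 ρ := by
  intro i j hij x x' hx h1 h2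
  rw [h.eq_half_iff hρ] at h1 h2
  have key : ∀ (k l : Fin n) (a b : ℝ), k ≠ l →
      weightedSum β (Pi.single k a - Pi.single l b) = β k * a - β l * b := by
    intro k l a b hkl
    rw [weightedSum, Fintype.sum_eq_add k l hkl]
    · simp [hkl, hkl.symm, sub_eq_add_neg]
    · rintro m ⟨hmk, hml⟩
      simp [hmk, hml]
  rw [key i j _ _ hij] at h1
  rw [key j i _ _ hij.symm] at h2
  rw [h.eq hρ, h.eq hρ, sub_zero, sub_zero]
  congr 1
  have hS : ∀ z : Fin n → ℝ, (∀ m, m ≠ i → m ≠ j → z m = 0) →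
      weightedSum β z = β i * z i + β j * z j := fun z hz =>
    Fintype.sum_eq_add i j hij fun k hk => by simp [hz k hk.1 hk.2]
  have hD : ∀ z : Fin n → ℝ, (∀ m, m ≠ i → m ≠ j → z m = 0) →
      weightedL1 β z = |β i * z i| + |β j * z j| := fun z hz =>
    Fintype.sum_eq_add i j hij fun k hk => by simp [hz k hk.1 hk.2]
  rw [l1Ratio, l1Ratio, hS x fun m a b => (hx m a b).1, hS x' fun m a b => (hx m a b).2,
    hD x fun m a b => (hx m a b).1, hD x' fun m a b => (hx m a b).2,
    show β i * x i = β j * x' j by linarith, show β j * x j = β i * x' i by linarith,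
    add_comm, add_comm |β j * x' j|]

lemma IsL1Rep.unique (hn : 2 ≤ n) (hρ : IsBCR ρ) {G' : ℝ → ℝ} {β' : Fin n → ℝ}
    (h : IsL1Rep ρ G β) (h' : IsL1Rep ρ G' β') :
    Set.EqOn G' G (Set.Icc (-1) 1) ∧ ∃ C : ℝ, 0 < C ∧ β' = C • β := by
  obtain ⟨a, b, hab⟩ : ∃ a b : Fin n, a ≠ b :=
    ⟨⟨0, by omega⟩, ⟨1, by omega⟩, by simp⟩
  have key : ∀ (γ : Fin n → ℝ) (k l : Fin n) (p q : ℝ), k ≠ l →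
      weightedSum γ (Pi.single k p + Pi.single l q) = γ k * p + γ l * q := by
    intro γ k l p q hkl
    rw [weightedSum, Fintype.sum_eq_add k l hkl]
    · simp [hkl, hkl.symm]
    · rintro m ⟨hmk, hml⟩
      simp [hmk, hml]
  have hiff : ∀ v, 0 ≤ weightedSum β v ↔ 0 ≤ weightedSum β' v := fun v => by
    have h1 := h.half_le_iff hρ v 0
    have h2 := h'.half_le_iff hρ v 0
    rw [sub_zero] at h1 h2
    rw [← h1, h2]
  have hzero : ∀ v, weightedSum β v = 0 → weightedSum β' v = 0 := fun v hv => by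
    have h1 := (hiff v).mp hv.ge
    have h2 := (hiff (-v)).mp (by rw [weightedSum_neg, hv, neg_zero])
    rw [weightedSum_neg] at h2
    linarith
  have hC : ∃ C : ℝ, 0 < C ∧ β' = C • β := by
    refine ⟨β' a / β a, ?_, ?_⟩
    · have h1 := (hiff (Pi.single a (β a) + Pi.single b 0)).mp (by
        rw [key _ _ _ _ _ hab]; nlinarith [mul_self_nonneg (β a)])
      rw [key _ _ _ _ _ hab, mul_zero, add_zero] at h1
      have h2 : 0 < β' a * β a := lt_of_le_of_ne h1 (mul_ne_zero (h'.1 a) (h.1 a)).symm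
      exact div_pos_iff.mpr (by rcases mul_pos_iff.mp h2 with h | h <;> tauto)
    · funext k
      rw [Pi.smul_apply, smul_eq_mul, div_mul_eq_mul_div, eq_div_iff (h.1 a)]
      by_cases hk : k = a
      · rw [hk]
      · have h1 := hzero (Pi.single k (β a) + Pi.single a (-β k)) (by
          rw [key _ _ _ _ _ hk]; ring)
        rw [key _ _ _ _ _ hk] at h1
        linarith
  refine ⟨fun r hr => ?_, hC⟩
  obtain ⟨C, hC0, rfl⟩ := hC
  set v : Fin n → ℝ := Pi.single a ((1 + r) / 2 / β a) + Pi.single b (-((1 - r) / 2) / β b) with hv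
  have hS : weightedSum β v = r := by
    rw [hv, key _ _ _ _ _ hab, mul_div_cancel₀ _ (h.1 a), mul_div_cancel₀ _ (h.1 b)]
    ring
  have hD : weightedL1 β v = 1 := by
    rw [weightedL1, Fintype.sum_eq_add a b hab]
    · simp only [hv, Pi.add_apply, Pi.single_eq_same, Pi.single_eq_of_ne hab,
        Pi.single_eq_of_ne hab.symm, add_zero, zero_add]
      rw [mul_div_cancel₀ _ (h.1 a), mul_div_cancel₀ _ (h.1 b), abs_neg,
        abs_of_nonneg (by linarith [hr.1]), abs_of_nonneg (by linarith [hr.2])]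
      ring
    · rintro m ⟨hma, hmb⟩
      simp [hv, hma, hmb]
  have hR : l1Ratio β v = r := by rw [l1Ratio, hS, hD, div_one]
  have h1 := h.eq hρ v 0
  have h2 := h'.eq hρ v 0
  rw [sub_zero, l1Ratio_smul_left _ hC0, hR] at h2
  rw [sub_zero, hR] at h1
  rw [← h1, ← h2]

end Representation

/-- A function of the attribute differences inducing a continuous, linear and moderately
transitive binary choice rule. -/
structure IsDirectional (f : (Fin n → ℝ) → ℝ) : Prop where
  mem (v) : f v ∈ Set.Icc (0 : ℝ) 1
  neg (v) : f (-v) = 1 - f v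
  smul (c : ℝ) (hc : 0 < c) (v) : f (c • v) = f v
  cont : ContinuousOn f {v | v ≠ 0}
  moderate (u v) (hu : 1 / 2 ≤ f u) (hv : 1 / 2 ≤ f v) :
    min (f u) (f v) < f (u + v) ∨ (f (u + v) = f u ∧ f (u + v) = f v)

namespace IsDirectional

variable {f : (Fin n → ℝ) → ℝ}

lemma zero (hf : IsDirectional f) : f 0 = 1 / 2 := by
  have := hf.neg 0
  rw [neg_zero] at this
  linarith

lemma min_le_add (hf : IsDirectional f) {u v : Fin n → ℝ} (hu : 1 / 2 ≤ f u) (hv : 1 / 2 ≤ f v) :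
    min (f u) (f v) ≤ f (u + v) := by
  rcases hf.moderate u v hu hv with h | ⟨h, _⟩
  · exact h.le
  · exact h ▸ min_le_left _ _

lemma half_le_add (hf : IsDirectional f) {u v : Fin n → ℝ} (hu : 1 / 2 ≤ f u) (hv : 1 / 2 ≤ f v) :
    1 / 2 ≤ f (u + v) :=
  (le_min hu hv).trans (hf.min_le_add hu hv)

lemma add_eq_half (hf : IsDirectional f) {u v : Fin n → ℝ} (hu : f u = 1 / 2) (hv : f v = 1 / 2) :
    f (u + v) = 1 / 2 := by
  have h1 := hf.half_le_add hu.ge hv.ge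
  have h2 := hf.half_le_add (u := -u) (v := -v) (by rw [hf.neg]; linarith)
    (by rw [hf.neg]; linarith)
  rw [← neg_add, hf.neg] at h2
  linarith

lemma smul_eq_half (hf : IsDirectional f) {v : Fin n → ℝ} (hv : f v = 1 / 2) (c : ℝ) : f (c • v) = 1 / 2 := by
  rcases lt_trichotomy c 0 with hc | rfl | hc
  · rw [show c • v = -((-c) • v) by simp, hf.neg, hf.smul _ (neg_pos.mpr hc), hv]
    norm_num
  · rw [zero_smul, hf.zero]
  · rw [hf.smul c hc, hv]

lemma half_le_congr (hf : IsDirectional f) {u v : Fin n → ℝ} (h : f (v - u) = 1 / 2) :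
    1 / 2 ≤ f u ↔ 1 / 2 ≤ f v := by
  constructor
  · intro hu
    have := hf.half_le_add hu h.ge
    rwa [add_sub_cancel] at this
  · intro hv
    have h' : f (u - v) = 1 / 2 := by
      rw [← neg_sub, hf.neg, h]; norm_num
    have := hf.half_le_add hv h'.ge
    rwa [add_sub_cancel] at this

/-- Intermediate values between two linearly independent directions of opposite sign. -/
lemma exists_balance (hf : IsDirectional f) {u v : Fin n → ℝ} (hu : 1 / 2 < f u)
    (hne : ∀ a b : ℝ, a • v + b • u = 0 → a = 0 ∧ b = 0) : ∃ b : ℝ, f (v - b • u) = 1 / 2 := by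
  have key : ∀ s : ℝ, s ≠ 0 → (1 / 2 : ℝ) ∈ Set.uIcc (f v) (f (s • u)) → f (s • u) ≠ 1 / 2 →
      ∃ b : ℝ, f (v - b • u) = 1 / 2 := by
    intro s hs hmem hend
    let γ : ℝ → Fin n → ℝ := fun t => (1 - t) • v + (t * s) • u
    have hγ : ∀ t, γ t ≠ 0 := by
      intro t ht
      obtain ⟨h1, h2⟩ := hne _ _ ht
      rcases mul_eq_zero.mp h2 with h | h
      · linarith
      · exact hs h
    have hcont : ContinuousOn (fun t => f (γ t)) (Set.uIcc 0 1) :=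
      hf.cont.comp (by fun_prop) fun t _ => hγ t
    have := intermediate_value_uIcc hcont
    obtain ⟨t, -, ht⟩ := this (a := 1 / 2) (by simpa [γ] using hmem)
    have ht1 : 1 - t ≠ 0 := by
      intro h
      have h' : t = 1 := by linarith
      subst h'
      apply hend
      simpa [γ] using ht
    refine ⟨-(t * s / (1 - t)), ?_⟩
    have := hf.smul_eq_half ht (1 - t)⁻¹
    rwa [show (1 - t)⁻¹ • γ t = v - (-(t * s / (1 - t))) • u by
      simp only [γ, smul_add, smul_smul]
      rw [inv_mul_cancel₀ ht1, one_smul, neg_smul, sub_neg_eq_add, div_eq_inv_mul]] at this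
  have hneg := hf.neg u
  rcases le_total (f v) (1 / 2) with h | h
  · exact key 1 one_ne_zero (by rw [one_smul]; exact Set.mem_uIcc_of_le h hu.le)
      (by rw [one_smul]; exact hu.ne')
  · exact key (-1) (by norm_num)
      (by rw [neg_one_smul]; exact Set.mem_uIcc_of_ge (by linarith) h)
      (by rw [neg_one_smul]; linarith)

/-- The indifference set is the kernel of a linear form with nonzero coefficients. -/
lemma exists_weights (hf : IsDirectional f) (hn : 2 ≤ n) (hne : ∀ k, f (Pi.single k 1) ≠ 1 / 2) :
    ∃ β : Fin n → ℝ, (∀ k, β k ≠ 0) ∧ ∀ v, 1 / 2 ≤ f v ↔ 0 ≤ weightedSum β v := by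
  obtain ⟨k₀⟩ : Nonempty (Fin n) := ⟨⟨0, by omega⟩⟩
  obtain ⟨s, hs, hu⟩ : ∃ s : ℝ, s ≠ 0 ∧ 1 / 2 < f (s • Pi.single k₀ 1) := by
    rcases lt_or_gt_of_ne (hne k₀) with h | h
    · refine ⟨-1, by norm_num, ?_⟩
      rw [neg_one_smul, hf.neg]
      linarith
    · exact ⟨1, one_ne_zero, by rwa [one_smul]⟩
  set u : Fin n → ℝ := s • Pi.single k₀ 1 with hu_def
  have hbal : ∀ k, ∃ b : ℝ, f (Pi.single k 1 - b • u) = 1 / 2 := by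
    intro k
    by_cases hk : k = k₀
    · subst hk
      refine ⟨s⁻¹, ?_⟩
      rw [hu_def, smul_smul, inv_mul_cancel₀ hs, one_smul, sub_self, hf.zero]
    · refine hf.exists_balance hu fun a b hab => ?_
      have h1 := congrFun hab k
      have h2 := congrFun hab k₀
      simp [hu_def, hk, Ne.symm hk, hs] at h1 h2
      exact ⟨h1, h2⟩
  choose β hβ using hbal
  refine ⟨β, fun k h0 => hne k ?_, fun v => ?_⟩
  · simpa [h0] using hβ k
  have h1 : f (v - weightedSum β v • u) = 1 / 2 := by
    have : v - weightedSum β v • u = ∑ k, v k • (Pi.single k 1 - β k • u) := by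
      simp only [smul_sub, Finset.sum_sub_distrib, smul_smul, weightedSum, Finset.sum_smul]
      congr 1
      · funext i
        simp [Finset.sum_apply, Pi.single_apply]
      · simp only [mul_comm]
    rw [this]
    exact Finset.sum_induction _ (fun w => f w = 1 / 2) (fun _ _ => hf.add_eq_half) hf.zero
      fun k _ => hf.smul_eq_half (hβ k) _
  rw [← hf.half_le_congr h1]
  rcases lt_trichotomy (weightedSum β v) 0 with hc | hc | hc
  · rw [← neg_neg (weightedSum β v • u), ← neg_smul, hf.neg, hf.smul _ (neg_pos.mpr hc)]
    constructor <;> intro h <;> linarith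
  · rw [hc, zero_smul, hf.zero]
    simp
  · rw [hf.smul _ hc]
    exact ⟨fun _ => hc.le, fun _ => hu.le⟩

end IsDirectional

/-- A directional rule in normalized attributes (all weights equal to one) that satisfies
dominance, simplification and exchangeability. -/
structure IsNormalized (g : (Fin n → ℝ) → ℝ) : Prop extends IsDirectional g where
  half_le_iff (w) : 1 / 2 ≤ g w ↔ 0 ≤ ∑ k, w k
  dominance (w z) (hw : ∀ k, 0 ≤ w k) (hw0 : w ≠ 0) (hz : ∃ k, z k < 0) : g z < g w
  merge (w) (i j) (hij : i ≠ j) (hw : 0 ≤ ∑ k, w k) :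
    g w ≤ g (Function.update (Function.update w i 0) j (w i + w j))
  swap (i j) (hij : i ≠ j) (a b : ℝ) :
    g (Pi.single i a + Pi.single j b) = g (Pi.single j a + Pi.single i b)

lemma sum_single_add_single (i j : Fin n) (p q : ℝ) :
    ∑ k, (Pi.single i p + Pi.single j q : Fin n → ℝ) k = p + q := by
  simp [Finset.sum_add_distrib]

/-- Moving the total of coordinate `i` onto coordinate `j`. -/
def mergeInto (w : Fin n → ℝ) (i j : Fin n) : Fin n → ℝ :=
  Function.update (Function.update w i 0) j (w i + w j)

section Merge

variable {w : Fin n → ℝ} {i j : Fin n}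

lemma mergeInto_left (hij : i ≠ j) : mergeInto w i j i = 0 := by
  simp [mergeInto, hij]

lemma mergeInto_right : mergeInto w i j j = w i + w j := by
  simp [mergeInto]

lemma mergeInto_of_ne {k : Fin n} (hi : k ≠ i) (hj : k ≠ j) : mergeInto w i j k = w k := by
  simp [mergeInto, hi, hj]

lemma sum_comp_mergeInto (hij : i ≠ j) (F : ℝ → ℝ) (h0 : F 0 = 0)
    (hF : F (w i + w j) = F (w i) + F (w j)) :
    ∑ k, F (mergeInto w i j k) = ∑ k, F (w k) := by
  rw [← sub_eq_zero, ← Finset.sum_sub_distrib, Fintype.sum_eq_add i j hij]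
  · rw [mergeInto_left hij, mergeInto_right, h0, hF]
    ring
  · rintro k ⟨hi, hj⟩
    rw [mergeInto_of_ne hi hj, sub_self]

lemma card_support_mergeInto_lt (hij : i ≠ j) (hi : w i ≠ 0) (hj : w j ≠ 0) :
    #{k | mergeInto w i j k ≠ 0} < #{k | w k ≠ 0} := by
  refine Finset.card_lt_card (Finset.ssubset_iff_of_subset ?_ |>.mpr ⟨i, ?_, ?_⟩)
  · intro k
    simp only [Finset.mem_filter, Finset.mem_univ, true_and]
    intro hk
    by_cases hkj : k = j
    · rwa [hkj]
    by_cases hki : k = i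
    · rwa [hki]
    rwa [mergeInto_of_ne hki hkj] at hk
  · simpa using hi
  · simp [mergeInto_left hij]

lemma eq_smul_add_smul_mergeInto (hij : i ≠ j) (h : w i + w j ≠ 0) :
    w = (w j / (w i + w j)) • mergeInto w i j + (w i / (w i + w j)) • mergeInto w j i := by
  funext k
  simp only [Pi.add_apply, Pi.smul_apply, smul_eq_mul]
  by_cases hkj : k = j
  · subst hkj
    rw [mergeInto_right, mergeInto_left hij.symm]
    field_simp
    ring
  by_cases hki : k = i
  · subst hki
    rw [mergeInto_right, mergeInto_left hij, add_comm (w j)]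
    field_simp
    ring
  rw [mergeInto_of_ne hki hkj, mergeInto_of_ne hkj hki]
  field_simp
  ring

end Merge

namespace IsNormalized

variable {g : (Fin n → ℝ) → ℝ}

lemma move_left (hg : IsNormalized g) {a b c : Fin n} (hab : a ≠ b) (hcb : c ≠ b) {p q : ℝ} (h : 0 ≤ p + q) :
    g (Pi.single a p + Pi.single b q) = g (Pi.single c p + Pi.single b q) := by
  have key : ∀ a c : Fin n, a ≠ b → c ≠ b →
      g (Pi.single a p + Pi.single b q) ≤ g (Pi.single c p + Pi.single b q) := by
    intro a c hab hcb
    by_cases hac : a = c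
    · rw [hac]
    refine (hg.merge _ a c hac (by rwa [sum_single_add_single])).trans_eq (congrArg g ?_)
    funext k
    by_cases hkc : k = c
    · subst hkc
      simp [Ne.symm hac, hab, hcb]
    by_cases hka : k = a
    · subst hka
      simp [hkc, hab]
    simp [hkc, hka]
  exact le_antisymm (key a c hab hcb) (key c a hcb hab)

lemma move_right (hg : IsNormalized g) {a b d : Fin n} (hab : a ≠ b) (had : a ≠ d) {p q : ℝ} (h : 0 ≤ p + q) :
    g (Pi.single a p + Pi.single b q) = g (Pi.single a p + Pi.single d q) := by
  rw [add_comm, add_comm (Pi.single a p : Fin n → ℝ)]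
  exact hg.move_left hab.symm had.symm (by linarith)

lemma move (hg : IsNormalized g) {a b c d : Fin n} (hab : a ≠ b) (hcd : c ≠ d) {p q : ℝ} (h : 0 ≤ p + q) :
    g (Pi.single a p + Pi.single b q) = g (Pi.single c p + Pi.single d q) := by
  by_cases had : a = d
  · subst had
    rw [hg.swap a b hab, hg.move_left hab.symm hcd h]
  · rw [hg.move_right hab had h, hg.move_left had hcd h]

end IsNormalized

/-- A vector with nonnegative total and no two coordinates of the same sign is supported on
one positive and one nonpositive coordinate. -/
lemma exists_eq_single_add_single (hn : 2 ≤ n) {w : Fin n → ℝ} (hw : w ≠ 0)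
    (hs : 0 ≤ ∑ k, w k) (h : ∀ i j, i ≠ j → w i * w j ≤ 0) :
    ∃ a b, a ≠ b ∧ 0 < w a ∧ w b ≤ 0 ∧ w = Pi.single a (w a) + Pi.single b (w b) := by
  obtain ⟨a, ha⟩ : ∃ a, 0 < w a := by
    by_contra! hc
    have h0 := le_antisymm (Finset.sum_nonpos fun k _ => hc k) hs
    have h1 := (Finset.sum_eq_zero_iff_of_nonpos fun k _ => hc k).mp h0
    exact hw (funext fun k => h1 k (Finset.mem_univ _))
  have hle : ∀ b, b ≠ a → w b ≤ 0 := fun b hb => by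
    by_contra! hc
    exact absurd (h a b hb.symm) (not_le.mpr (mul_pos ha hc))
  obtain ⟨b, hba, hb⟩ : ∃ b, b ≠ a ∧ ∀ c, c ≠ a → c ≠ b → w c = 0 := by
    by_cases hex : ∃ b, b ≠ a ∧ w b ≠ 0
    · obtain ⟨b, hba, hb⟩ := hex
      refine ⟨b, hba, fun c hca hcb => ?_⟩
      by_contra hc
      have h1 := lt_of_le_of_ne (hle b hba) hb
      have h2 := lt_of_le_of_ne (hle c hca) hc
      exact absurd (h c b hcb) (not_le.mpr (mul_pos_of_neg_of_neg h2 h1))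
    · push Not at hex
      have : Nontrivial (Fin n) := Fin.nontrivial_iff_two_le.mpr hn
      obtain ⟨b, hb⟩ := exists_ne a
      exact ⟨b, hb, fun c hca _ => hex c hca⟩
  refine ⟨a, b, hba.symm, ha, hle b hba, ?_⟩
  funext k
  by_cases hka : k = a
  · subst hka
    simp [hba]
  by_cases hkb : k = b
  · subst hkb
    simp [hka]
  simp [hka, hkb, hb k hka hkb]

/-- The trade-off between coordinates `a` and `b` with value-to-distance ratio `r`. -/
noncomputable def tradeoff (a b : Fin n) (r : ℝ) : Fin n → ℝ :=
  Pi.single a ((1 + r) / 2) + Pi.single b (-((1 - r) / 2))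

lemma tradeoff_ne_zero {a b : Fin n} (hab : a ≠ b) (r : ℝ) : tradeoff a b r ≠ 0 := by
  intro h
  have h1 := congrFun h a
  have h2 := congrFun h b
  simp [tradeoff, hab, hab.symm] at h1 h2
  linarith

lemma sum_tradeoff (a b : Fin n) (r : ℝ) : ∑ k, tradeoff a b r k = r := by
  rw [tradeoff, sum_single_add_single]
  ring

namespace IsNormalized

variable {g : (Fin n → ℝ) → ℝ}

lemma eq_tradeoff (hg : IsNormalized g) (hn : 2 ≤ n) {a b : Fin n} (hab : a ≠ b) (w : Fin n → ℝ) (hw : w ≠ 0)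
    (hs : 0 ≤ ∑ k, w k) : g w = g (tradeoff a b ((∑ k, w k) / ∑ k, |w k|)) := by
  induction hm : #{k | w k ≠ 0} using Nat.strong_induction_on generalizing w with
  | _ m ih =>
  subst hm
  by_cases hex : ∃ i j, i ≠ j ∧ 0 < w i * w j
  · obtain ⟨i, j, hij, hpos⟩ := hex
    have step : ∀ i j, i ≠ j → 0 < w i * w j →
        g (mergeInto w i j) = g (tradeoff a b ((∑ k, w k) / ∑ k, |w k|)) ∧
          0 ≤ ∑ k, mergeInto w i j k := by
      intro i j hij hpos
      have hi : w i ≠ 0 := fun h => by simp [h] at hpos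
      have hj : w j ≠ 0 := fun h => by simp [h] at hpos
      have h1 : ∑ k, mergeInto w i j k = ∑ k, w k :=
        sum_comp_mergeInto hij (fun x => x) rfl rfl
      have h2 : ∑ k, |mergeInto w i j k| = ∑ k, |w k| := by
        refine sum_comp_mergeInto hij (fun x => |x|) abs_zero ?_
        rcases pos_and_pos_or_neg_and_neg_of_mul_pos hpos with h | h
        · exact abs_add_eq_add_abs_iff _ _ |>.mpr (Or.inl ⟨h.1.le, h.2.le⟩)
        · exact abs_add_eq_add_abs_iff _ _ |>.mpr (Or.inr ⟨h.1.le, h.2.le⟩)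
      have h3 : mergeInto w i j ≠ 0 := by
        intro h
        have h4 := congrFun h j
        rw [mergeInto_right, Pi.zero_apply] at h4
        rw [eq_neg_of_add_eq_zero_left h4] at hpos
        nlinarith [mul_self_nonneg (w j)]
      have := ih _ (card_support_mergeInto_lt hij hi hj) _ h3 (by rwa [h1]) rfl
      rw [h1, h2] at this
      exact ⟨this, by rwa [h1]⟩
    obtain ⟨e1, s1⟩ := step i j hij hpos
    obtain ⟨e2, s2⟩ := step j i hij.symm (by rwa [mul_comm])
    refine le_antisymm ((hg.merge w i j hij hs).trans_eq e1) ?_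
    have hsum : 0 < w j / (w i + w j) ∧ 0 < w i / (w i + w j) ∧ w i + w j ≠ 0 := by
      rcases pos_and_pos_or_neg_and_neg_of_mul_pos hpos with ⟨h, h'⟩ | ⟨h, h'⟩
      · exact ⟨div_pos h' (add_pos h h'), div_pos h (add_pos h h'), (add_pos h h').ne'⟩
      · exact ⟨div_pos_of_neg_of_neg h' (add_neg h h'), div_pos_of_neg_of_neg h (add_neg h h'),
          (add_neg h h').ne⟩
    rw [eq_smul_add_smul_mergeInto hij hsum.2.2]
    have := hg.min_le_add (u := (w j / (w i + w j)) • mergeInto w i j)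
      (v := (w i / (w i + w j)) • mergeInto w j i)
      (by rw [hg.smul _ hsum.1]; exact (hg.half_le_iff _).mpr s1)
      (by rw [hg.smul _ hsum.2.1]; exact (hg.half_le_iff _).mpr s2)
    rw [hg.smul _ hsum.1, hg.smul _ hsum.2.1, e1, e2, min_self,
      ← eq_smul_add_smul_mergeInto hij hsum.2.2] at this
    rwa [← eq_smul_add_smul_mergeInto hij hsum.2.2]
  · push Not at hex
    obtain ⟨c, d, hcd, hc, hd, he⟩ := exists_eq_single_add_single hn hw hs hex
    have h1 : ∑ k, w k = w c + w d := by
      conv_lhs => rw [he]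
      exact sum_single_add_single _ _ _ _
    have h2 : ∑ k, |w k| = w c - w d := by
      rw [Fintype.sum_eq_add c d hcd, abs_of_pos hc, abs_of_nonpos hd, sub_eq_add_neg]
      rintro k ⟨hkc, hkd⟩
      rw [he]
      simp [hkc, hkd]
    have hpos : 0 < w c - w d := by linarith
    rw [h1] at hs
    rw [he, hg.move hcd hab hs, ← he, h1, h2, ← hg.smul _ hpos (tradeoff a b _)]
    congr 1
    rw [tradeoff, smul_add, ← Pi.single_smul, ← Pi.single_smul]
    congr 2
    · simp only [smul_eq_mul]
      field_simp
      ring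
    · simp only [smul_eq_mul]
      field_simp
      ring

lemma tradeoff_neg (hg : IsNormalized g) {a b : Fin n} (hab : a ≠ b) (r : ℝ) :
    g (tradeoff a b r) = 1 - g (tradeoff a b (-r)) := by
  rw [← hg.neg, tradeoff, tradeoff, hg.swap a b hab, neg_add, ← Pi.single_neg, ← Pi.single_neg,
    add_comm]
  congr 3
  all_goals ring

lemma tradeoff_lt (hg : IsNormalized g) {a b : Fin n} (hab : a ≠ b) {r s : ℝ} (hr : 0 ≤ r) (hrs : r < s)
    (hs : s ≤ 1) : g (tradeoff a b r) < g (tradeoff a b s) := by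
  have hmax : g (tradeoff a b r) < g (Pi.single a 1) := by
    refine hg.dominance _ _ (fun k => ?_) (by simp) ⟨b, ?_⟩
    · by_cases hk : k = a
      · subst hk; simp
      · simp [hk]
    · simp [tradeoff, hab.symm]
      linarith
  rcases hs.eq_or_lt with rfl | hs
  · refine hmax.trans_eq (congrArg g ?_)
    simp [tradeoff]
  have hr1 : 0 < 1 - r := by linarith
  have hl : 0 < (1 - s) / (1 - r) := div_pos (by linarith) hr1
  have hc : 0 < (s - r) / (1 - r) := div_pos (by linarith) hr1
  have hdec : tradeoff a b s =
      ((1 - s) / (1 - r)) • tradeoff a b r + ((s - r) / (1 - r)) • Pi.single a 1 := by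
    rw [tradeoff, tradeoff, smul_add, ← Pi.single_smul, ← Pi.single_smul, ← Pi.single_smul,
      add_right_comm, ← Pi.single_add]
    congr 2
    · simp only [smul_eq_mul]
      field_simp
      ring
    · simp only [smul_eq_mul]
      field_simp
  have hhalf : 1 / 2 ≤ g (tradeoff a b r) := (hg.half_le_iff _).mpr (by rwa [sum_tradeoff])
  have := hg.moderate (((1 - s) / (1 - r)) • tradeoff a b r)
    (((s - r) / (1 - r)) • Pi.single a 1)
    (by rwa [hg.smul _ hl]) (by rw [hg.smul _ hc]; linarith)
  rw [← hdec, hg.smul _ hl, hg.smul _ hc, min_eq_left hmax.le] at this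
  rcases this with h | ⟨h1, h2⟩
  · exact h
  · linarith

lemma strictMonoOn_tradeoff (hg : IsNormalized g) {a b : Fin n} (hab : a ≠ b) :
    StrictMonoOn (fun r => g (tradeoff a b r)) (Set.Icc (-1) 1) := by
  intro r hr s hs hrs
  have h0 : g (tradeoff a b 0) = 1 / 2 := by
    have := hg.tradeoff_neg hab 0
    rw [neg_zero] at this
    linarith
  have hpos : ∀ t, 0 < t → t ≤ 1 → 1 / 2 < g (tradeoff a b t) := fun t ht ht1 =>
    h0 ▸ hg.tradeoff_lt hab le_rfl ht ht1
  have hnr := hg.tradeoff_neg hab r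
  have hns := hg.tradeoff_neg hab s
  show g (tradeoff a b r) < g (tradeoff a b s)
  rcases le_or_gt 0 r with h | h
  · exact hg.tradeoff_lt hab h hrs hs.2
  have hr' := hpos (-r) (by linarith) (by linarith [hr.1])
  rcases le_or_gt s 0 with h' | h'
  · have := hg.tradeoff_lt hab (r := -s) (s := -r) (by linarith) (by linarith)
      (by linarith [hr.1])
    linarith
  · have := hpos s h' hs.2
    linarith

/-- A normalized rule is a strictly increasing function of the value-to-distance ratio. -/
lemma exists_ratio (hg : IsNormalized g) (hn : 2 ≤ n) : ∃ G : ℝ → ℝ, ContinuousOn G (Set.Icc (-1) 1) ∧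
    StrictMonoOn G (Set.Icc (-1) 1) ∧ (∀ r, G r ∈ Set.Icc (0 : ℝ) 1 ∧ G r = 1 - G (-r)) ∧
    ∀ w, w ≠ 0 → g w = G ((∑ k, w k) / ∑ k, |w k|) := by
  obtain ⟨a, b, hab⟩ : ∃ a b : Fin n, a ≠ b :=
    ⟨⟨0, by omega⟩, ⟨1, by omega⟩, by simp⟩
  refine ⟨fun r => g (tradeoff a b r), ?_, hg.strictMonoOn_tradeoff hab,
    fun r => ⟨hg.mem _, hg.tradeoff_neg hab r⟩, fun w hw => ?_⟩
  · refine hg.cont.comp ?_ fun r _ => tradeoff_ne_zero hab r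
    unfold tradeoff
    refine Continuous.continuousOn (Continuous.add ?_ ?_)
    · exact (continuous_single a).comp (by fun_prop)
    · exact (continuous_single b).comp (by fun_prop)
  · rcases le_total 0 (∑ k, w k) with h | h
    · exact hg.eq_tradeoff hn hab w hw h
    · have := hg.eq_tradeoff hn hab (-w) (neg_ne_zero.mpr hw) (by simpa using h)
      simp only [Pi.neg_apply, abs_neg, Finset.sum_neg_distrib, neg_div] at this
      rw [hg.neg] at this
      have h2 := hg.tradeoff_neg hab ((∑ k, w k) / ∑ k, |w k|)
      simp only
      linarith

end IsNormalized

section Axioms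

variable {ρ : (Fin n → ℝ) → (Fin n → ℝ) → ℝ}

lemma M2.eq_sub (h2 : M2 ρ) (x y : Fin n → ℝ) : ρ x y = ρ (x - y) 0 := by
  rw [h2 x y (-y) (1 / 2) (by norm_num) (by norm_num),
    h2 (x - y) 0 0 (1 / 2) (by norm_num) (by norm_num)]
  congr 1
  · rw [smul_sub, smul_zero, add_zero, smul_neg]
    norm_num [sub_eq_add_neg]
  · rw [smul_zero, smul_zero, smul_neg]
    norm_num

lemma M2.smul (h2 : M2 ρ) {c : ℝ} (hc : 0 < c) (v : Fin n → ℝ) : ρ (c • v) 0 = ρ v 0 := by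
  have key : ∀ (c : ℝ) (v : Fin n → ℝ), 0 < c → c < 1 → ρ (c • v) 0 = ρ v 0 := by
    intro c v h0 h1
    have := h2 v 0 0 c h0 h1
    simpa using this.symm
  rcases lt_trichotomy c 1 with h | rfl | h
  · exact key c v hc h
  · rw [one_smul]
  · have := key c⁻¹ (c • v) (inv_pos.mpr hc) (inv_lt_one_of_one_lt₀ h)
    rw [smul_smul, inv_mul_cancel₀ hc.ne', one_smul] at this
    exact this.symm

lemma isDirectional_of_axioms (hρ : IsBCR ρ) (h1 : M1 ρ) (h2 : M2 ρ) (h3 : M3 ρ) :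
    IsDirectional fun v => ρ v 0 where
  mem v := hρ.1 v 0
  neg v := by rw [hρ.2 (-v) 0, h2.eq_sub 0 (-v), sub_neg_eq_add, zero_add]
  smul c hc v := h2.smul hc v
  cont := h1.comp (f := fun v : Fin n → ℝ => (v, (0 : Fin n → ℝ))) (by fun_prop) fun v hv => hv
  moderate u v hu hv := by
    have e1 : ρ (u + v) v = ρ u 0 := by rw [h2.eq_sub, add_sub_cancel_right]
    have := h3 (u + v) v 0 (by rwa [e1]) hv
    rwa [e1] at this

lemma apply_single_ne_half (hρ : IsBCR ρ) (h1 : M1 ρ) (h2 : M2 ρ) (h3 : M3 ρ) {k : Fin n}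
    (hk : ¬ NullAttr ρ k) : ρ (Pi.single k 1) 0 ≠ 1 / 2 := by
  intro h
  refine hk fun x y z => ?_
  have hf := isDirectional_of_axioms hρ h1 h2 h3
  have := hf.smul_eq_half h (x k - y k)
  rw [h2.eq_sub]
  convert this using 2
  funext i
  by_cases hi : i = k
  · subst hi; simp
  · simp [hi]

lemma isNormalized_of_axioms (hρ : IsBCR ρ) (h1 : M1 ρ) (h2 : M2 ρ) (h3 : M3 ρ) (h4 : M4 ρ)
    (h5 : M5 ρ) (h6 : M6 ρ) {β : Fin n → ℝ} (hβ : ∀ k, β k ≠ 0)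
    (hiff : ∀ v, 1 / 2 ≤ ρ v 0 ↔ 0 ≤ weightedSum β v) :
    IsNormalized fun w => ρ (w / β) 0 := by
  have hf := isDirectional_of_axioms hρ h1 h2 h3
  have hsum : ∀ w : Fin n → ℝ, weightedSum β (w / β) = ∑ k, w k := fun w =>
    Finset.sum_congr rfl fun k _ => mul_div_cancel₀ _ (hβ k)
  have hhalf : ∀ w : Fin n → ℝ, 1 / 2 ≤ ρ (w / β) 0 ↔ 0 ≤ ∑ k, w k := fun w => by
    rw [hiff, hsum]
  have hzero : ∀ v : Fin n → ℝ, weightedSum β v = 0 → ρ v 0 = 1 / 2 := fun v hv => by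
    have e1 := (hiff v).mpr hv.ge
    have e2 := (hiff (-v)).mpr (by rw [weightedSum_neg, hv, neg_zero])
    have e3 := hf.neg v
    linarith
  have hne : ∀ w : Fin n → ℝ, w ≠ 0 → w / β ≠ 0 := fun w hw h => by
    obtain ⟨k, hk⟩ := Function.ne_iff.mp hw
    exact div_ne_zero hk (hβ k) (congrFun h k)
  have hadd : ∀ u v : Fin n → ℝ, (u + v) / β = u / β + v / β := fun u v =>
    funext fun k => add_div _ _ _
  have hdom1 : ∀ (w : Fin n → ℝ) (k), 1 / 2 ≤ ρ (Function.update 0 k ((w / β) k)) 0 ↔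
      0 ≤ w k := fun w k => by
    have := weightedSum_update_sub β (w / β) 0 k
    rw [sub_zero, sub_zero, Pi.div_apply, mul_div_cancel₀ _ (hβ k)] at this
    rw [hiff, Pi.div_apply, this]
  refine ⟨⟨fun w => hρ.1 _ _, fun w => ?_, fun c hc w => ?_, ?_, fun u v hu hv => ?_⟩, hhalf,
    fun w z hw hw0 hz => ?_, fun w i j hij hw => ?_, fun i j hij a b => ?_⟩
  · rw [neg_div, hf.neg]
  · rw [show (c • w) / β = c • (w / β) from smul_div_assoc c w β]
    exact h2.smul hc _
  · refine hf.cont.comp (f := fun w : Fin n → ℝ => w / β) ?_ fun w hw => hne w hw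
    refine Continuous.continuousOn (continuous_pi fun k => ?_)
    simp only [Pi.div_apply]
    fun_prop
  · have := hf.moderate _ _ hu hv
    rwa [← hadd] at this
  · refine (h4 (w / β) 0 ⟨fun k => (hdom1 w k).mpr (hw k), ?_⟩ (z / β) 0).2 ?_
    · obtain ⟨k, hk⟩ := Function.ne_iff.mp hw0
      refine ⟨k, ?_⟩
      have hk' : ¬ 1 / 2 ≤ ρ (Function.update 0 k ((-w / β) k)) 0 := by
        rw [hdom1, Pi.neg_apply, neg_nonneg, not_le]
        exact lt_of_le_of_ne (hw k) (Ne.symm hk)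
      have e : Function.update (0 : Fin n → ℝ) k ((-w / β) k) =
          -Function.update (0 : Fin n → ℝ) k ((w / β) k) := by
        rw [neg_div, Pi.neg_apply]
        funext i
        by_cases hi : i = k
        · subst hi; simp
        · simp [hi]
      have e2 := hf.neg (Function.update (0 : Fin n → ℝ) k ((w / β) k))
      rw [e, e2] at hk'
      linarith
    · rintro ⟨hd, -⟩
      obtain ⟨k, hk⟩ := hz
      exact absurd ((hdom1 z k).mp (hd k)) (not_le.mpr hk)
  · refine h5 (w / β) 0 (mergeInto w i j / β) ((hhalf w).mpr hw) ⟨i, ?_, ?_⟩ ?_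
    · rw [Pi.div_apply, mergeInto_left hij, zero_div, Pi.zero_apply]
    · have hoth : ∀ k, k ≠ i → (mergeInto w i j / β) k ≠ (w / β) k → k = j := by
        intro k hki hk
        by_contra hkj
        exact hk (by rw [Pi.div_apply, Pi.div_apply, mergeInto_of_ne hki hkj])
      intro k l hk hl hk' hl'
      rw [hoth k hk hk', hoth l hl hl']
    · rw [h2.eq_sub]
      refine hzero _ ?_
      rw [weightedSum_sub, hsum, hsum, sub_eq_zero]
      exact sum_comp_mergeInto hij (fun x => x) rfl rfl
  · have hdiv : ∀ (i j : Fin n) (a b : ℝ), (Pi.single i a + Pi.single j b) / β =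
        Pi.single i (a / β i) + Pi.single j (b / β j) := by
      have hsingle : ∀ (i : Fin n) (a : ℝ), (Pi.single i a : Fin n → ℝ) / β =
          Pi.single i (a / β i) := by
        intro i a
        funext k
        by_cases hk : k = i
        · subst hk; simp
        · simp [hk]
      intro i j a b
      rw [hadd, hsingle, hsingle]
    have hind : ∀ (i j : Fin n) (a : ℝ), ρ (Pi.single i (a / β i)) (Pi.single j (a / β j)) =
        1 / 2 := by
      intro i j a
      rw [h2.eq_sub]
      refine hzero _ ?_
      simp [weightedSum, mul_sub, Finset.sum_sub_distrib, Pi.single_apply,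
        mul_div_cancel₀ _ (hβ _)]
    rw [hdiv, hdiv]
    refine h6 i j hij _ _ (fun m hmi hmj => ?_) ?_ ?_
    · simp [hmi, hmj]
    · simpa [hij, hij.symm] using hind i j a
    · simpa [hij, hij.symm] using hind j i b

lemma exists_isL1Rep_of_axioms (hn : 2 ≤ n) (hρ : IsBCR ρ) (hnonnull : ∀ k, ¬ NullAttr ρ k)
    (h1 : M1 ρ) (h2 : M2 ρ) (h3 : M3 ρ) (h4 : M4 ρ) (h5 : M5 ρ) (h6 : M6 ρ) :
    ∃ G β, IsL1Rep ρ G β := by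
  obtain ⟨β, hβ, hiff⟩ := (isDirectional_of_axioms hρ h1 h2 h3).exists_weights hn
    fun k => apply_single_ne_half hρ h1 h2 h3 (hnonnull k)
  obtain ⟨G, hcont, hmono, hodd, hG⟩ :=
    (isNormalized_of_axioms hρ h1 h2 h3 h4 h5 h6 hβ hiff).exists_ratio hn
  refine ⟨G, β, hβ, hcont, hmono, fun r _ => hodd r, fun x y hxy => ?_⟩
  have hne : β * (x - y) ≠ 0 := fun h => by
    refine hxy (funext fun k => sub_eq_zero.mp ?_)
    exact (mul_eq_zero.mp (congrFun h k)).resolve_left (hβ k)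
  have := hG _ hne
  rw [show β * (x - y) / β = x - y from funext fun k => mul_div_cancel_left₀ _ (hβ k)] at this
  rw [h2.eq_sub, this]
  simp only [Pi.mul_apply, Pi.sub_apply, mul_sub, Finset.sum_sub_distrib]

end Axioms

/-- Theorem 2 — for n ≥ 2, M1–M6 characterize the L1-complexity
representation, with uniqueness of (G, β) up to positive scaling of β. -/
theorem stmt_4 {n : ℕ} (hn : 2 ≤ n) (ρ : (Fin n → ℝ) → (Fin n → ℝ) → ℝ)
    (hρ : IsBCR ρ) (hnonnull : ∀ k, ¬ NullAttr ρ k) :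
    ((M1 ρ ∧ M2 ρ ∧ M3 ρ ∧ M4 ρ ∧ M5 ρ ∧ M6 ρ) ↔ ∃ G β, IsL1Rep ρ G β) ∧
    (∀ G β G' β', IsL1Rep ρ G β → IsL1Rep ρ G' β' →
      Set.EqOn G' G (Set.Icc (-1) 1) ∧ ∃ C : ℝ, 0 < C ∧ β' = C • β) := by
  refine ⟨⟨?_, ?_⟩, fun G β G' β' h h' => h.unique hn hρ h'⟩
  · rintro ⟨h1, h2, h3, h4, h5, h6⟩
    exact exists_isL1Rep_of_axioms hn hρ hnonnull h1 h2 h3 h4 h5 h6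
  · rintro ⟨G, β, h⟩
    exact ⟨h.m1 hρ, h.m2 hρ, h.m3 hρ, h.m4 hρ, h.m5 hρ, h.m6 hρ⟩
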